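/- arXiv:math/9912229 — 2 statements merged into one kernel-verified Lean document; each statement's English description precedes it below -/
import Mathlib

section
/- For every affine system of quasi-fans S in a lattice N and every primitive sublattice L of N there exists a prequotient of S by L, i.e., a map of systems of quasi-fans (P,𝔭) from S to an affine system of quasi-fans S̃ in some lattice Ñ such that L ⊆ ker(P), and such that for every map of systems of quasi-fans (F,𝔣) from S to an affine system of quasi-fans S' in a lattice N' with F|_L = 0 there is a unique map of systems of quasi-fans (F̃,𝔣̃) from S̃ to S' with (F,𝔣) = (F̃,𝔣̃) ∘ (P,𝔭). -/
open scoped TensorProduct Pointwise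

/-- A (not necessarily strictly) convex cone, as a subset of a real vector space:
it contains `0` and is closed under addition and under scaling by nonnegative reals. -/
def IsConeSet {V : Type*} [AddCommGroup V] [Module ℝ V] (τ : Set V) : Prop :=
  (0 : V) ∈ τ ∧ (∀ x ∈ τ, ∀ y ∈ τ, x + y ∈ τ) ∧ ∀ c : ℝ, 0 ≤ c → ∀ x ∈ τ, c • x ∈ τ

/-- `τ` is a face of the convex cone `σ`:  a convex subcone such that whenever the sum of
two elements of `σ` lies in `τ`, both elements lie in `τ`. -/
def IsFaceOf {V : Type*} [AddCommGroup V] [Module ℝ V] (τ σ : Set V) : Prop :=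
  IsConeSet τ ∧ τ ⊆ σ ∧ ∀ x ∈ σ, ∀ y ∈ σ, x + y ∈ τ → x ∈ τ ∧ y ∈ τ

/-- The relative interior of a convex cone (algebraic formulation, which for polyhedral
cones in a finite dimensional space agrees with the topological relative interior). -/
def coneRelint {V : Type*} [AddCommGroup V] [Module ℝ V] (σ : Set V) : Set V :=
  { x | x ∈ σ ∧ ∀ y ∈ σ, ∃ ε : ℝ, 0 < ε ∧ x - ε • y ∈ σ }

/-- The real vector space `N_ℝ = ℝ ⊗_ℤ N` associated to a lattice `N`. -/
abbrev NR (N : Type*) [AddCommGroup N] : Type _ := ℝ ⊗[ℤ] N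

/-- The canonical map `N → N_ℝ`, `n ↦ 1 ⊗ n`. -/
noncomputable def toNR {N : Type*} [AddCommGroup N] (n : N) : NR N := (1 : ℝ) ⊗ₜ[ℤ] n

/-- A rational polyhedral cone in the lattice `N`: a cone in `N_ℝ` generated by finitely
many lattice vectors. -/
def IsRatCone {N : Type*} [AddCommGroup N] (σ : Set (NR N)) : Prop :=
  ∃ (m : ℕ) (v : Fin m → N),
    σ = { x | ∃ c : Fin m → ℝ, (∀ k, 0 ≤ c k) ∧ x = ∑ k, c k • toNR (v k) }

/-- A quasi-fan in the lattice `N`: a finite set of rational polyhedral cones, closed under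
passing to faces, in which any two members intersect in a common face of both. -/
def IsQuasiFan {N : Type*} [AddCommGroup N] (Sig : Set (Set (NR N))) : Prop :=
  Sig.Finite ∧ (∀ σ ∈ Sig, IsRatCone σ) ∧
    (∀ σ ∈ Sig, ∀ τ, IsFaceOf τ σ → τ ∈ Sig) ∧
    ∀ σ ∈ Sig, ∀ σ' ∈ Sig, IsFaceOf (σ ∩ σ') σ ∧ IsFaceOf (σ ∩ σ') σ'

/-- A fan: a quasi-fan all of whose cones are strictly convex. -/
def IsFan {N : Type*} [AddCommGroup N] (Δ : Set (Set (NR N))) : Prop :=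
  IsQuasiFan Δ ∧ ∀ σ ∈ Δ, σ ∩ (-σ) = ({0} : Set (NR N))

/-- A system of quasi-fans in the lattice `N`, indexed by `I`. -/
structure SysQFan (N : Type*) [AddCommGroup N] (I : Type*) where
  D : I → I → Set (Set (NR N))
  isQF : ∀ i j, IsQuasiFan (D i j)
  symm : ∀ i j, D i j = D j i
  inter : ∀ i j k, D i j ∩ D j k ⊆ D i k

namespace SysQFan

variable {N : Type*} [AddCommGroup N] {I : Type*}

/-- A system of fans: a system of quasi-fans all of whose members are fans. -/
def IsFanSys (S : SysQFan N I) : Prop := ∀ i j, IsFan (S.D i j)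

/-- An affine system: each `Σ_ii` consists of all the faces of a single cone. -/
def IsAffine (S : SysQFan N I) : Prop := ∀ i, ∃ σ, S.D i i = { τ | IsFaceOf τ σ }

/-- The set `𝔉(S)` of labelled cones of a system of quasi-fans. -/
def LCone (S : SysQFan N I) := { p : Set (NR N) × I // p.1 ∈ S.D p.2 p.2 }

/-- The glueing relation `(σ,i) ∼ (τ,j) ↔ σ = τ ∧ σ ∈ Σ_ij` on labelled cones. -/
def glueSetoid (S : SysQFan N I) : Setoid (LCone S) where
  r p q := p.1.1 = q.1.1 ∧ p.1.1 ∈ S.D p.1.2 q.1.2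
  iseqv := by
    refine ⟨fun p => ⟨rfl, p.2⟩, fun {p q} h => ⟨h.1.symm, ?_⟩,
      fun {p q r} h h' => ⟨h.1.trans h'.1, ?_⟩⟩
    · rw [S.symm, ← h.1]; exact h.2
    · exact S.inter _ _ _ ⟨h.2, by rw [h.1]; exact h'.2⟩

/-- `Ω(S)`: the set of equivalence classes of labelled cones under the glueing relation. -/
def Omega (S : SysQFan N I) := Quotient (glueSetoid S)

/-- The class `[σ,i] ∈ Ω(S)` of a labelled cone `(σ,i)`. -/
def cls {S : SysQFan N I} (p : LCone S) : Omega S := Quotient.mk (glueSetoid S) p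

/-- The partial order on `Ω(S)`:  `[τ,j] ≺ [σ,i]` iff `τ ≺ σ` and `[τ,i] = [τ,j]`. -/
def le (S : SysQFan N I) (a b : Omega S) : Prop :=
  ∃ p q : LCone S, cls p = a ∧ cls q = b ∧ IsFaceOf p.1.1 q.1.1 ∧ p.1.1 ∈ S.D p.1.2 q.1.2

/-- A map of systems of quasi-fans: a lattice homomorphism `F` together with an order
preserving map `f : Ω(S) → Ω(S')` such that `f [σ,i] = [σ',i']` implies
`F_ℝ(σ°) ⊆ (σ')°`. -/
def IsSysMap {N' : Type*} [AddCommGroup N'] {I' : Type*} (S : SysQFan N I)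
    (S' : SysQFan N' I') (F : N →ₗ[ℤ] N') (f : Omega S → Omega S') : Prop :=
  (∀ a b : Omega S, le S a b → le S' (f a) (f b)) ∧
    ∀ (p : LCone S) (q : LCone S'), f (cls p) = cls q →
      (LinearMap.baseChange ℝ F) '' coneRelint p.1.1 ⊆ coneRelint q.1.1

/-- A single quasi-fan, regarded as a system of quasi-fans with one index. -/
def single {N' : Type*} [AddCommGroup N'] (Δ : Set (Set (NR N'))) (h : IsQuasiFan Δ) :
    SysQFan N' PUnit where
  D _ _ := Δ
  isQF _ _ := h
  symm _ _ := rfl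
  inter _ _ _ := fun _ hσ => hσ.1

end SysQFan

/-- A lattice: a finitely generated free `ℤ`-module. -/
structure LatticeData where
  carrier : Type
  [grp : AddCommGroup carrier]
  [free : Module.Free ℤ carrier]
  [fin : Module.Finite ℤ carrier]

attribute [instance] LatticeData.grp LatticeData.free LatticeData.fin

/-- The quotient `N ⧸ L` is torsion free, i.e. `L` is a primitive sublattice of `N`. -/
def TorsionFreeQuot {N : Type*} [AddCommGroup N] (L : Submodule ℤ N) : Prop :=
  ∀ (n : ℤ) (x : N ⧸ L), n • x = 0 → n = 0 ∨ x = 0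

section ConvexCone

variable {V W : Type*} [AddCommGroup V] [Module ℝ V] [AddCommGroup W] [Module ℝ W]

theorem IsConeSet.sum_mem {σ : Set V} (hσ : IsConeSet σ) {ι : Type*} (s : Finset ι)
    (f : ι → V) (h : ∀ i ∈ s, f i ∈ σ) : ∑ i ∈ s, f i ∈ σ :=
  Finset.sum_induction f (· ∈ σ) (fun a b ha hb => hσ.2.1 a ha b hb) hσ.1 h

theorem IsFaceOf.refl {σ : Set V} (hσ : IsConeSet σ) : IsFaceOf σ σ :=
  ⟨hσ, subset_rfl, fun _ hx _ hy _ => ⟨hx, hy⟩⟩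

theorem IsFaceOf.trans {ρ τ σ : Set V} (h : IsFaceOf ρ τ) (h' : IsFaceOf τ σ) :
    IsFaceOf ρ σ :=
  ⟨h.1, h.2.1.trans h'.2.1, fun x hx y hy hxy =>
    have := h'.2.2 x hx y hy (h.2.1 hxy)
    h.2.2 x this.1 y this.2 hxy⟩

theorem IsFaceOf.of_subset {ρ τ σ : Set V} (h : IsFaceOf ρ σ) (hρ : ρ ⊆ τ) (hτ : τ ⊆ σ) :
    IsFaceOf ρ τ :=
  ⟨h.1, hρ, fun x hx y hy hxy => h.2.2 x (hτ hx) y (hτ hy) hxy⟩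

theorem IsConeSet.inter {σ τ : Set V} (hσ : IsConeSet σ) (hτ : IsConeSet τ) :
    IsConeSet (σ ∩ τ) :=
  ⟨⟨hσ.1, hτ.1⟩, fun x hx y hy => ⟨hσ.2.1 x hx.1 y hy.1, hτ.2.1 x hx.2 y hy.2⟩,
    fun c hc x hx => ⟨hσ.2.2 c hc x hx.1, hτ.2.2 c hc x hx.2⟩⟩

theorem IsFaceOf.inter {ρ τ σ : Set V} (h : IsFaceOf ρ σ) (h' : IsFaceOf τ σ) :
    IsFaceOf (ρ ∩ τ) σ :=
  ⟨h.1.inter h'.1, Set.inter_subset_left.trans h.2.1, fun x hx y hy hxy =>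
    have h₁ := h.2.2 x hx y hy hxy.1
    have h₂ := h'.2.2 x hx y hy hxy.2
    ⟨⟨h₁.1, h₂.1⟩, ⟨h₁.2, h₂.2⟩⟩⟩

theorem IsConeSet.preimage {σ : Set W} (hσ : IsConeSet σ) (A : V →ₗ[ℝ] W) :
    IsConeSet (A ⁻¹' σ) :=
  ⟨by simpa using hσ.1, fun x hx y hy => by simpa using hσ.2.1 _ hx _ hy,
    fun c hc x hx => by simpa using hσ.2.2 c hc _ hx⟩

theorem IsFaceOf.preimage {τ σ : Set W} (h : IsFaceOf τ σ) (A : V →ₗ[ℝ] W) :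
    IsFaceOf (A ⁻¹' τ) (A ⁻¹' σ) :=
  ⟨h.1.preimage A, Set.preimage_mono h.2.1, fun x hx y hy hxy =>
    h.2.2 _ hx _ hy (by simpa using hxy)⟩

theorem IsConeSet.mem_of_smul_mem {σ : Set V} (hσ : IsConeSet σ) {c : ℝ} (hc : 0 < c) {x : V}
    (h : c • x ∈ σ) : x ∈ σ := by
  simpa [smul_smul, inv_mul_cancel₀ hc.ne'] using hσ.2.2 c⁻¹ (inv_nonneg.2 hc.le) _ h

/-- A face of `σ` containing a relative interior point of a subset `ψ` of `σ` contains `ψ`. -/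
theorem IsFaceOf.subset_of_mem_relint {φ σ ψ : Set V} (h : IsFaceOf φ σ) (hσ : IsConeSet σ)
    (hψ : ψ ⊆ σ) {w : V} (hw : w ∈ coneRelint ψ) (hwφ : w ∈ φ) : ψ ⊆ φ := by
  intro y hy
  obtain ⟨ε, hε, hy'⟩ := hw.2 y hy
  have := h.2.2 (w - ε • y) (hψ hy') (ε • y) (hσ.2.2 ε hε.le y (hψ hy)) (by simpa using hwφ)
  exact h.1.mem_of_smul_mem hε this.2

theorem eq_of_mem_relint {φ ψ σ : Set V} (hσ : IsConeSet σ) (h : IsFaceOf φ σ)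
    (h' : IsFaceOf ψ σ) {w : V} (hw : w ∈ coneRelint φ) (hw' : w ∈ coneRelint ψ) : φ = ψ :=
  (h'.subset_of_mem_relint hσ h.2.1 hw hw'.1).antisymm
    (h.subset_of_mem_relint hσ h'.2.1 hw' hw.1)

/-- If a linear map sends `τ` into the cone `σ` and some point of `τ` into the relative interior
of `σ`, then it sends the relative interior of `τ` into that of `σ`. -/
theorem map_mem_relint {τ : Set V} {σ : Set W} (hσ : IsConeSet σ) (A : V →ₗ[ℝ] W)
    (hA : ∀ x ∈ τ, A x ∈ σ) {w : V} (hw : w ∈ τ) (hwσ : A w ∈ coneRelint σ) {v : V}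
    (hv : v ∈ coneRelint τ) : A v ∈ coneRelint σ := by
  refine ⟨hA v hv.1, fun y hy => ?_⟩
  obtain ⟨ε, hε, h₁⟩ := hv.2 w hw
  obtain ⟨δ, hδ, h₂⟩ := hwσ.2 y hy
  refine ⟨ε * δ, mul_pos hε hδ, ?_⟩
  have := hσ.2.1 _ (hA _ h₁) _ (hσ.2.2 ε hε.le _ h₂)
  convert this using 1
  simp only [map_sub, map_smul, smul_sub, smul_smul]
  abel

/-- The smallest face of the cone `σ` containing `w`. -/
def faceAt (σ : Set V) (w : V) : Set V :=
  { y | y ∈ σ ∧ ∃ ε : ℝ, 0 < ε ∧ w - ε • y ∈ σ }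

theorem isFaceOf_faceAt {σ : Set V} (hσ : IsConeSet σ) {w : V} (hw : w ∈ σ) :
    IsFaceOf (faceAt σ w) σ := by
  refine ⟨⟨⟨hσ.1, 1, one_pos, by simpa using hw⟩, ?_, ?_⟩, fun y hy => hy.1, ?_⟩
  · rintro y ⟨hy, ε, hε, h₁⟩ z ⟨hz, δ, hδ, h₂⟩
    refine ⟨hσ.2.1 _ hy _ hz, ε * δ / (ε + δ), by positivity, ?_⟩
    have := hσ.2.1 _ (hσ.2.2 (δ / (ε + δ)) (by positivity) _ h₁) _
      (hσ.2.2 (ε / (ε + δ)) (by positivity) _ h₂)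
    convert this using 1
    match_scalars <;> field_simp
    ring
  · rintro c hc y ⟨hy, ε, hε, h₁⟩
    refine ⟨hσ.2.2 c hc y hy, ε / (c + 1), by positivity, ?_⟩
    have := hσ.2.1 _ h₁ _ (hσ.2.2 (ε / (c + 1)) (by positivity) _ hy)
    convert this using 1
    match_scalars <;> field_simp
    ring
  · have key : ∀ x ∈ σ, ∀ y ∈ σ, x + y ∈ faceAt σ w → x ∈ faceAt σ w := by
      rintro x hx y hy ⟨-, ε, hε, h⟩
      refine ⟨hx, ε, hε, ?_⟩
      have := hσ.2.1 _ h _ (hσ.2.2 ε hε.le _ hy)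
      convert this using 1
      module
    exact fun x hx y hy h => ⟨key x hx y hy h, key y hy x hx (by rwa [add_comm])⟩

theorem mem_relint_faceAt {σ : Set V} (hσ : IsConeSet σ) {w : V} (hw : w ∈ σ) :
    w ∈ coneRelint (faceAt σ w) := by
  have hmem : w ∈ faceAt σ w := ⟨hw, 1, one_pos, by simpa using hσ.1⟩
  refine ⟨hmem, ?_⟩
  rintro y ⟨hy, ε, hε, h⟩
  exact ⟨ε, hε, ((isFaceOf_faceAt hσ hw).2.2 _ h _ (hσ.2.2 ε hε.le _ hy)
    (by simpa using hmem)).1⟩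

/-- The cone generated by a set of vectors. -/
def coneGen (A : Set V) : Set V := (Submodule.span {c : ℝ // 0 ≤ c} A : Set V)

theorem isConeSet_coneGen (A : Set V) : IsConeSet (coneGen A) :=
  ⟨Submodule.zero_mem _, fun _ hx _ hy => Submodule.add_mem _ hx hy, fun c hc _ hx =>
    Submodule.smul_mem _ (⟨c, hc⟩ : {c : ℝ // 0 ≤ c}) hx⟩

theorem subset_coneGen (A : Set V) : A ⊆ coneGen A := Submodule.subset_span

theorem coneGen_mono {A B : Set V} (h : A ⊆ B) : coneGen A ⊆ coneGen B := Submodule.span_mono h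

theorem coneGen_subset {A σ : Set V} (hσ : IsConeSet σ) (h : A ⊆ σ) : coneGen A ⊆ σ := by
  intro x hx
  induction hx using Submodule.span_induction with
  | mem x hx => exact h hx
  | zero => exact hσ.1
  | add x y _ _ hx hy => exact hσ.2.1 _ hx _ hy
  | smul c x _ hx => exact hσ.2.2 c c.2 x hx

/-- Elements of a generated cone lying in a face `φ` are generated by the generators in `φ`. -/
theorem IsFaceOf.mem_coneGen_inter {A φ σ : Set V} (h : IsFaceOf φ σ) (hσ : IsConeSet σ)
    (hA : A ⊆ σ) {x : V} (hx : x ∈ coneGen A) (hxφ : x ∈ φ) : x ∈ coneGen (A ∩ φ) := by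
  have hsub := coneGen_subset hσ hA
  induction hx using Submodule.span_induction with
  | mem x hx => exact subset_coneGen _ ⟨hx, hxφ⟩
  | zero => exact (isConeSet_coneGen _).1
  | add x y hx hy ihx ihy =>
    have := h.2.2 x (hsub hx) y (hsub hy) hxφ
    exact (isConeSet_coneGen _).2.1 _ (ihx this.1) _ (ihy this.2)
  | smul c x hx ih =>
    rcases c.2.eq_or_lt with hc | hc
    · have : c • x = 0 := by rw [show c = 0 from Subtype.ext hc.symm, zero_smul]
      rw [this]
      exact (isConeSet_coneGen _).1
    · exact (isConeSet_coneGen _).2.2 c c.2 x (ih (h.1.mem_of_smul_mem hc hxφ))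

theorem IsFaceOf.eq_coneGen {A φ : Set V} (h : IsFaceOf φ (coneGen A)) :
    φ = coneGen (A ∩ φ) :=
  Set.Subset.antisymm
    (fun _ hx => h.mem_coneGen_inter (isConeSet_coneGen A) (subset_coneGen A) (h.2.1 hx) hx)
    (coneGen_subset h.1 Set.inter_subset_right)

theorem finite_faces_coneGen {A : Set V} (hA : A.Finite) :
    { φ | IsFaceOf φ (coneGen A) }.Finite :=
  (hA.finite_subsets.image coneGen).subset fun φ hφ =>
    ⟨A ∩ φ, Set.inter_subset_left, (IsFaceOf.eq_coneGen hφ).symm⟩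

theorem relint_coneGen_nonempty {A : Set V} (hA : A.Finite) :
    (coneRelint (coneGen A)).Nonempty := by
  have hc := isConeSet_coneGen A
  have hgen : ∀ x ∈ A, x ∈ coneGen A := subset_coneGen A
  refine ⟨∑ x ∈ hA.toFinset, x, hc.sum_mem _ _ (by simpa using hgen), fun y hy => ?_⟩
  suffices h : coneGen A ⊆ faceAt (coneGen A) (∑ x ∈ hA.toFinset, x) from (h hy).2
  refine coneGen_subset (isFaceOf_faceAt hc (hc.sum_mem _ _ (by simpa using hgen))).1 ?_
  intro x hx
  refine ⟨hgen x hx, 1, one_pos, ?_⟩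
  classical
  rw [one_smul, ← Finset.sum_erase_eq_sub (by simpa using hx)]
  refine hc.sum_mem _ _ fun z hz => hgen z ?_
  simpa using Finset.mem_of_mem_erase hz

end ConvexCone

section RationalCone

variable {N : Type*} [AddCommGroup N]

theorem isRatCone_iff {σ : Set (NR N)} :
    IsRatCone σ ↔ ∃ A : Set N, A.Finite ∧ σ = coneGen (toNR '' A) := by
  have key : ∀ (m : ℕ) (v : Fin m → N),
      { x | ∃ c : Fin m → ℝ, (∀ k, 0 ≤ c k) ∧ x = ∑ k, c k • toNR (v k) } =
        coneGen (toNR '' Set.range v) := by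
    intro m v
    ext x
    rw [← Set.range_comp, coneGen, SetLike.mem_coe, Submodule.mem_span_range_iff_exists_fun]
    constructor
    · rintro ⟨c, hc, rfl⟩
      exact ⟨fun k => ⟨c k, hc k⟩, rfl⟩
    · rintro ⟨c, rfl⟩
      exact ⟨fun k => c k, fun k => (c k).2, rfl⟩
  constructor
  · rintro ⟨m, v, rfl⟩
    exact ⟨Set.range v, Set.finite_range v, key m v⟩
  · rintro ⟨A, hA, rfl⟩
    obtain ⟨m, v, -, rfl⟩ := hA.fin_param
    exact ⟨m, v, (key m v).symm⟩

theorem IsRatCone.isConeSet {σ : Set (NR N)} (h : IsRatCone σ) : IsConeSet σ := by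
  obtain ⟨A, -, rfl⟩ := isRatCone_iff.1 h
  exact isConeSet_coneGen _

theorem IsRatCone.relint_nonempty {σ : Set (NR N)} (h : IsRatCone σ) :
    (coneRelint σ).Nonempty := by
  obtain ⟨A, hA, rfl⟩ := isRatCone_iff.1 h
  exact relint_coneGen_nonempty (hA.image _)

theorem IsRatCone.finite_faces {σ : Set (NR N)} (h : IsRatCone σ) :
    { φ | IsFaceOf φ σ }.Finite := by
  obtain ⟨A, hA, rfl⟩ := isRatCone_iff.1 h
  exact finite_faces_coneGen (hA.image _)

theorem IsRatCone.of_isFaceOf {φ σ : Set (NR N)} (h : IsRatCone σ) (hφ : IsFaceOf φ σ) :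
    IsRatCone φ := by
  obtain ⟨A, hA, rfl⟩ := isRatCone_iff.1 h
  refine isRatCone_iff.2 ⟨A ∩ toNR ⁻¹' φ, hA.inter_of_left _, ?_⟩
  rw [Set.image_inter_preimage]
  exact hφ.eq_coneGen

/-- A face-closed family of faces of a rational cone is a quasi-fan. -/
theorem IsRatCone.isQuasiFan {σ : Set (NR N)} (h : IsRatCone σ) {D : Set (Set (NR N))}
    (hD : ∀ φ ∈ D, IsFaceOf φ σ) (hD' : ∀ φ ∈ D, ∀ ψ, IsFaceOf ψ φ → ψ ∈ D) :
    IsQuasiFan D :=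
  ⟨h.finite_faces.subset hD, fun φ hφ => h.of_isFaceOf (hD φ hφ), hD', fun φ hφ ψ hψ =>
    have := (hD φ hφ).inter (hD ψ hψ)
    ⟨this.of_subset Set.inter_subset_left (hD φ hφ).2.1,
      this.of_subset Set.inter_subset_right (hD ψ hψ).2.1⟩⟩

end RationalCone

section FaceHull

variable {Ω V W : Type*} [AddCommGroup V] [Module ℝ V] [AddCommGroup W] [Module ℝ W]

theorem IsConeSet.image {σ : Set V} (hσ : IsConeSet σ) (A : V →ₗ[ℝ] W) : IsConeSet (A '' σ) := by
  refine ⟨⟨0, hσ.1, map_zero A⟩, ?_, ?_⟩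
  · rintro _ ⟨x, hx, rfl⟩ _ ⟨y, hy, rfl⟩
    exact ⟨x + y, hσ.2.1 x hx y hy, map_add A x y⟩
  · rintro c hc _ ⟨x, hx, rfl⟩
    exact ⟨c • x, hσ.2.2 c hc x hx, map_smul A c x⟩

/-- The family `θ` of cones contains `C` and turns `r` into the face relation. -/
def IsFaceFamily (r : Ω → Ω → Prop) (C θ : Ω → Set V) : Prop :=
  (∀ a, IsConeSet (θ a)) ∧ (∀ a, C a ⊆ θ a) ∧ ∀ a b, r a b → IsFaceOf (θ a) (θ b)

/-- The smallest family of cones containing `C` that turns `r` into the face relation. -/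
def faceHull (r : Ω → Ω → Prop) (C : Ω → Set V) (a : Ω) : Set V :=
  { x | ∀ θ, IsFaceFamily r C θ → x ∈ θ a }

theorem isFaceFamily_faceHull (r : Ω → Ω → Prop) (C : Ω → Set V) :
    IsFaceFamily r C (faceHull r C) := by
  have hcone : ∀ a, IsConeSet (faceHull r C a) := fun a =>
    ⟨fun θ hθ => (hθ.1 a).1, fun x hx y hy θ hθ => (hθ.1 a).2.1 x (hx θ hθ) y (hy θ hθ),
      fun c hc x hx θ hθ => (hθ.1 a).2.2 c hc x (hx θ hθ)⟩
  refine ⟨hcone, fun a x hx θ hθ => hθ.2.1 a hx, fun a b hab => ⟨hcone a, ?_, ?_⟩⟩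
  · exact fun x hx θ hθ => (hθ.2.2 a b hab).2.1 (hx θ hθ)
  · intro x hx y hy hxy
    have h : ∀ θ, IsFaceFamily r C θ → x ∈ θ a ∧ y ∈ θ a := fun θ hθ =>
      (hθ.2.2 a b hab).2.2 x (hx θ hθ) y (hy θ hθ) (hxy θ hθ)
    exact ⟨fun θ hθ => (h θ hθ).1, fun θ hθ => (h θ hθ).2⟩

theorem faceHull_subset {r : Ω → Ω → Prop} {C θ : Ω → Set V} (hθ : IsFaceFamily r C θ) (a : Ω) :
    faceHull r C a ⊆ θ a := fun _ hx => hx θ hθ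

/-- No proper face of `faceHull r C a` contains `C a`. -/
theorem exists_sub_mem_faceHull {r : Ω → Ω → Prop} {C : Ω → Set V} (hC : ∀ a, IsConeSet (C a))
    (hr : ∀ a b, r a b → C a ⊆ C b) {a : Ω} {y : V} (hy : y ∈ faceHull r C a) :
    ∃ x ∈ C a, x - y ∈ faceHull r C a := by
  obtain ⟨hcone, hsub, hface⟩ := isFaceFamily_faceHull r C
  suffices h : IsFaceFamily r C
      (fun a => { y | y ∈ faceHull r C a ∧ ∃ x ∈ C a, x - y ∈ faceHull r C a }) from
    (faceHull_subset h a hy).2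
  have hcone' : ∀ a, IsConeSet { y | y ∈ faceHull r C a ∧ ∃ x ∈ C a, x - y ∈ faceHull r C a } := by
    refine fun a => ⟨⟨(hcone a).1, 0, (hC a).1, by simpa using (hcone a).1⟩, ?_, ?_⟩
    · rintro y ⟨hy, x, hx, hxy⟩ y' ⟨hy', x', hx', hxy'⟩
      refine ⟨(hcone a).2.1 _ hy _ hy', x + x', (hC a).2.1 _ hx _ hx', ?_⟩
      rw [add_sub_add_comm]
      exact (hcone a).2.1 _ hxy _ hxy'
    · rintro c hc y ⟨hy, x, hx, hxy⟩
      refine ⟨(hcone a).2.2 c hc _ hy, c • x, (hC a).2.2 c hc _ hx, ?_⟩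
      rw [← smul_sub]
      exact (hcone a).2.2 c hc _ hxy
  refine ⟨hcone', fun a x hx => ⟨hsub a hx, x, hx, by simpa using (hcone a).1⟩,
    fun a b hab => ⟨hcone' a, ?_, ?_⟩⟩
  · rintro y ⟨hy, x, hx, hxy⟩
    exact ⟨(hface a b hab).2.1 hy, x, hr a b hab hx, (hface a b hab).2.1 hxy⟩
  · rintro y ⟨hy, -⟩ z ⟨hz, -⟩ ⟨hyz, x, hx, hxyz⟩
    obtain ⟨hya, hza⟩ := (hface a b hab).2.2 y hy z hz hyz
    refine ⟨⟨hya, x, hx, ?_⟩, ⟨hza, x, hx, ?_⟩⟩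
    · convert (hcone a).2.1 _ hxyz _ hza using 1
      abel
    · convert (hcone a).2.1 _ hxyz _ hya using 1
      abel

theorem relint_subset_relint_faceHull {r : Ω → Ω → Prop} {C : Ω → Set V}
    (hC : ∀ a, IsConeSet (C a)) (hr : ∀ a b, r a b → C a ⊆ C b) (a : Ω) :
    coneRelint (C a) ⊆ coneRelint (faceHull r C a) := by
  obtain ⟨hcone, hsub, -⟩ := isFaceFamily_faceHull r C
  refine fun w hw => ⟨hsub a hw.1, fun y hy => ?_⟩
  obtain ⟨x, hx, hxy⟩ := exists_sub_mem_faceHull hC hr hy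
  obtain ⟨ε, hε, h⟩ := hw.2 x hx
  refine ⟨ε, hε, ?_⟩
  convert (hcone a).2.1 _ (hsub a h) _ ((hcone a).2.2 ε hε.le _ hxy) using 1
  module

theorem faceHull_coneGen (r : Ω → Ω → Prop) (G : Ω → Set V) (a : Ω) :
    faceHull r (fun a => coneGen (G a)) a =
      coneGen ((⋃ b, G b) ∩ faceHull r (fun a => coneGen (G a)) a) := by
  set τ := faceHull r (fun a => coneGen (G a)) with hτ
  obtain ⟨hcone, hsub, hface⟩ := isFaceFamily_faceHull r (fun a => coneGen (G a))
  refine (faceHull_subset (θ := fun a => coneGen ((⋃ b, G b) ∩ τ a)) ⟨?_, ?_, ?_⟩ a).antisymm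
    (coneGen_subset (hcone a) Set.inter_subset_right)
  · exact fun a => isConeSet_coneGen _
  · exact fun a => coneGen_mono (Set.subset_inter (Set.subset_iUnion G a)
      ((subset_coneGen _).trans (hsub a)))
  · intro a b hab
    refine ⟨isConeSet_coneGen _,
      coneGen_mono (Set.inter_subset_inter_right _ (hface a b hab).2.1), ?_⟩
    have hτ' : ∀ a, coneGen ((⋃ b, G b) ∩ τ a) ⊆ τ a := fun a =>
      coneGen_subset (hcone a) Set.inter_subset_right
    have key : ∀ x ∈ coneGen ((⋃ b, G b) ∩ τ b), x ∈ τ a → x ∈ coneGen ((⋃ b, G b) ∩ τ a) :=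
      fun x hx hxa => coneGen_mono (by gcongr; exact Set.inter_subset_left)
        ((hface a b hab).mem_coneGen_inter (hcone b) Set.inter_subset_right hx hxa)
    intro x hx y hy hxy
    have := (hface a b hab).2.2 x (hτ' b hx) y (hτ' b hy) (hτ' a hxy)
    exact ⟨key x hx this.1, key y hy this.2⟩

end FaceHull

section RationalFaceHull

variable {N M : Type*} [AddCommGroup N] [AddCommGroup M]

theorem baseChange_toNR (F : N →ₗ[ℤ] M) (n : N) :
    LinearMap.baseChange ℝ F (toNR n) = toNR (F n) := LinearMap.baseChange_tmul ..

theorem IsRatCone.image {σ : Set (NR N)} (h : IsRatCone σ) (F : N →ₗ[ℤ] M) :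
    IsRatCone (LinearMap.baseChange ℝ F '' σ) := by
  obtain ⟨A, hA, rfl⟩ := isRatCone_iff.1 h
  refine isRatCone_iff.2 ⟨F '' A, hA.image _, Set.Subset.antisymm ?_ ?_⟩
  · rw [Set.image_subset_iff]
    refine coneGen_subset ((isConeSet_coneGen _).preimage _) ?_
    rintro _ ⟨n, hn, rfl⟩
    exact subset_coneGen _ ⟨F n, ⟨n, hn, rfl⟩, (baseChange_toNR F n).symm⟩
  · refine coneGen_subset ((isConeSet_coneGen _).image _) ?_
    rintro _ ⟨_, ⟨n, hn, rfl⟩, rfl⟩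
    exact ⟨toNR n, subset_coneGen _ ⟨n, hn, rfl⟩, baseChange_toNR F n⟩

theorem IsRatCone.faceHull {Ω : Type*} [Finite Ω] (r : Ω → Ω → Prop) {C : Ω → Set (NR N)}
    (hC : ∀ a, IsRatCone (C a)) (a : Ω) : IsRatCone (faceHull r C a) := by
  choose G hG hCG using fun a => isRatCone_iff.1 (hC a)
  obtain rfl : C = fun a => coneGen (toNR '' G a) := funext hCG
  refine isRatCone_iff.2 ⟨(⋃ b, G b) ∩
    toNR ⁻¹' _root_.faceHull r (fun a => coneGen (toNR '' G a)) a,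
    (Set.finite_iUnion hG).inter_of_left _, ?_⟩
  rw [Set.image_inter_preimage, Set.image_iUnion]
  exact faceHull_coneGen ..

end RationalFaceHull

namespace SysQFan

section Order

variable {N : Type*} [AddCommGroup N] {I : Type*} {S : SysQFan N I}

/-- The cone underlying a class `[σ,i]`. -/
def coneOf (a : Omega S) : Set (NR N) :=
  Quotient.lift (fun p : LCone S => p.1.1) (fun p q (h : p.1.1 = q.1.1 ∧ _) => h.1) a

theorem exists_cls (a : Omega S) : ∃ p : LCone S, cls p = a := Quotient.exists_rep a

theorem cls_eq_iff {p q : LCone S} : cls p = cls q ↔ p.1.1 = q.1.1 ∧ p.1.1 ∈ S.D p.1.2 q.1.2 :=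
  Quotient.eq

theorem isRatCone_coneOf (a : Omega S) : IsRatCone (coneOf a) := by
  obtain ⟨p, rfl⟩ := exists_cls a
  exact (S.isQF _ _).2.1 _ p.2

theorem isConeSet_coneOf (a : Omega S) : IsConeSet (coneOf a) := (isRatCone_coneOf a).isConeSet

/-- The elements below `[σ,i]` are the classes `[φ,i]` of the faces `φ` of `σ`. -/
theorem le_cls_iff {a : Omega S} {q : LCone S} :
    le S a (cls q) ↔ ∃ (φ : Set (NR N)) (h : φ ∈ S.D q.1.2 q.1.2),
      IsFaceOf φ q.1.1 ∧ a = cls ⟨(φ, q.1.2), h⟩ := by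
  constructor
  · rintro ⟨p, q', rfl, hq, hf, hp⟩
    rw [cls_eq_iff] at hq
    have hf' : IsFaceOf p.1.1 q.1.1 := hq.1 ▸ hf
    refine ⟨p.1.1, (S.isQF _ _).2.2.1 _ q.2 _ hf', hf', cls_eq_iff.2 ⟨rfl, ?_⟩⟩
    exact S.inter _ _ _ ⟨hp, (S.isQF _ _).2.2.1 _ hq.2 _ hf⟩
  · rintro ⟨φ, h, hf, rfl⟩
    exact ⟨_, q, rfl, rfl, hf, h⟩

theorem le_refl (a : Omega S) : le S a a := by
  obtain ⟨p, rfl⟩ := exists_cls a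
  exact ⟨p, p, rfl, rfl, IsFaceOf.refl (isConeSet_coneOf (cls p)), p.2⟩

theorem le_trans {a b c : Omega S} (hab : le S a b) (hbc : le S b c) : le S a c := by
  obtain ⟨r, rfl⟩ := exists_cls c
  obtain ⟨φ, h, hφ, rfl⟩ := le_cls_iff.1 hbc
  obtain ⟨ψ, h', hψ, rfl⟩ := le_cls_iff.1 hab
  exact le_cls_iff.2 ⟨ψ, h', hψ.trans hφ, rfl⟩

theorem isFaceOf_of_le {a b : Omega S} (h : le S a b) : IsFaceOf (coneOf a) (coneOf b) := by
  obtain ⟨q, rfl⟩ := exists_cls b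
  obtain ⟨φ, h, hφ, rfl⟩ := le_cls_iff.1 h
  exact hφ

theorem exists_le_of_isFaceOf {b : Omega S} {φ : Set (NR N)} (h : IsFaceOf φ (coneOf b)) :
    ∃ a, le S a b ∧ coneOf a = φ := by
  obtain ⟨q, rfl⟩ := exists_cls b
  have := (S.isQF _ _).2.2.1 _ q.2 _ h
  exact ⟨cls ⟨(φ, q.1.2), this⟩, le_cls_iff.2 ⟨φ, this, h, rfl⟩, rfl⟩

theorem le_of_subset {a a' b : Omega S} (h : le S a b) (h' : le S a' b)
    (hsub : coneOf a ⊆ coneOf a') : le S a a' := by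
  obtain ⟨q, rfl⟩ := exists_cls b
  obtain ⟨φ, hmem, hφ, rfl⟩ := le_cls_iff.1 h
  obtain ⟨ψ, hmem', hψ, rfl⟩ := le_cls_iff.1 h'
  exact le_cls_iff.2 ⟨φ, hmem, hφ.of_subset hsub hψ.2.1, rfl⟩

theorem eq_of_coneOf_eq {a a' b : Omega S} (h : le S a b) (h' : le S a' b)
    (heq : coneOf a = coneOf a') : a = a' := by
  obtain ⟨q, rfl⟩ := exists_cls b
  obtain ⟨φ, h, hφ, rfl⟩ := le_cls_iff.1 h
  obtain ⟨ψ, h', hψ, rfl⟩ := le_cls_iff.1 h'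
  obtain rfl : φ = ψ := heq
  rfl

theorem finite_omega [Finite I] (S : SysQFan N I) : Finite (Omega S) := by
  have : Finite (LCone S) := by
    refine Set.Finite.to_subtype (Set.Finite.subset (s := ⋃ i, (fun σ => (σ, i)) '' S.D i i)
      (Set.finite_iUnion fun i => (S.isQF i i).1.image _) ?_)
    rintro ⟨σ, i⟩ h
    exact Set.mem_iUnion.2 ⟨i, σ, h, rfl⟩
  exact Quotient.finite _

variable {N' : Type*} [AddCommGroup N'] {I' : Type*} {S' : SysQFan N' I'}

theorem isSysMap_iff {F : N →ₗ[ℤ] N'} {f : Omega S → Omega S'} :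
    IsSysMap S S' F f ↔ (∀ a b, le S a b → le S' (f a) (f b)) ∧
      ∀ a, ∀ x ∈ coneRelint (coneOf a), LinearMap.baseChange ℝ F x ∈ coneRelint (coneOf (f a)) := by
  refine and_congr_right fun _ => ⟨fun h a x hx => ?_, fun h p q hpq => ?_⟩
  · obtain ⟨p, rfl⟩ := exists_cls a
    obtain ⟨q, hq⟩ := exists_cls (f (cls p))
    rw [← hq]
    exact h p q hq.symm ⟨x, hx, rfl⟩
  · rintro _ ⟨x, hx, rfl⟩
    have := h (cls p) x hx
    rwa [hpq] at this

/-- A map of systems sends cones, not only their relative interiors, into their targets. -/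
theorem IsSysMap.map_mem {F : N →ₗ[ℤ] N'} {f : Omega S → Omega S'} (h : IsSysMap S S' F f)
    (a : Omega S) {x : NR N} (hx : x ∈ coneOf a) : LinearMap.baseChange ℝ F x ∈ coneOf (f a) := by
  rw [isSysMap_iff] at h
  have ha := isConeSet_coneOf a
  obtain ⟨b, hb, hbx⟩ := exists_le_of_isFaceOf (isFaceOf_faceAt ha hx)
  have := h.2 b x (hbx ▸ mem_relint_faceAt ha hx)
  exact (isFaceOf_of_le (h.1 b a hb)).2.1 this.1

end Order

section Prequotient

variable {N M : Type*} [AddCommGroup N] [AddCommGroup M] {I : Type*}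
  (S : SysQFan N I) (P : N →ₗ[ℤ] M)

/-- The cone of the prequotient of `S` along `P` attached to a class of `Ω(S)`. -/
def preCone : Omega S → Set (NR M) :=
  faceHull (le S) (fun a => LinearMap.baseChange ℝ P '' coneOf a)

/-- The elementary glueing steps for a cone `ρ` in the prequotient. -/
def preStep (ρ : Set (NR M)) (a b : Omega S) : Prop := le S a b ∧ IsFaceOf ρ (preCone S P a)

variable {S P}

theorem isFaceOf_preCone {a b : Omega S} (h : le S a b) :
    IsFaceOf (preCone S P a) (preCone S P b) := (isFaceFamily_faceHull _ _).2.2 a b h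

theorem map_mem_relint_preCone {a : Omega S} {x : NR N} (hx : x ∈ coneRelint (coneOf a)) :
    LinearMap.baseChange ℝ P x ∈ coneRelint (preCone S P a) := by
  refine relint_subset_relint_faceHull (fun a => (isConeSet_coneOf a).image _)
    (fun a b h => Set.image_mono (isFaceOf_of_le h).2.1) a ?_
  refine ⟨⟨x, hx.1, rfl⟩, ?_⟩
  rintro _ ⟨y, hy, rfl⟩
  obtain ⟨ε, hε, h⟩ := hx.2 y hy
  exact ⟨ε, hε, _, h, by simp⟩

theorem isFaceOf_preCone_of_eqvGen {ρ : Set (NR M)} {a b : Omega S}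
    (h : Relation.EqvGen (preStep S P ρ) a b) :
    IsFaceOf ρ (preCone S P a) ↔ IsFaceOf ρ (preCone S P b) := by
  induction h with
  | rel a b h => exact iff_of_true h.2 (h.2.trans (isFaceOf_preCone h.1))
  | refl => rfl
  | symm _ _ _ ih => exact ih.symm
  | trans _ _ _ _ _ ih ih' => exact ih.trans ih'

variable {N' : Type*} [AddCommGroup N'] {I' : Type*} {S' : SysQFan N' I'}
  {F : M →ₗ[ℤ] N'} {f : Omega S → Omega S'}

theorem map_mem_of_mem_preCone (hf : IsSysMap S S' (F.comp P) f) {a : Omega S} {x : NR M}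
    (hx : x ∈ preCone S P a) : LinearMap.baseChange ℝ F x ∈ coneOf (f a) := by
  refine faceHull_subset (θ := fun a => LinearMap.baseChange ℝ F ⁻¹' coneOf (f a))
    ⟨fun a => (isConeSet_coneOf _).preimage _, ?_, fun a b h =>
      (isFaceOf_of_le (hf.1 a b h)).preimage _⟩ a hx
  rintro a _ ⟨x, hx, rfl⟩
  simpa [LinearMap.baseChange_comp] using hf.map_mem a hx

variable [Finite I]

theorem isRatCone_preCone (a : Omega S) : IsRatCone (preCone S P a) :=
  have := finite_omega S
  IsRatCone.faceHull _ (fun a => (isRatCone_coneOf a).image P) a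

variable (S P)

/-- The prequotient of `S` along `P`: its charts are the cones `preCone S P a`, and two charts
are glued along a face `ρ` if they are linked by elementary glueing steps for `ρ`. -/
def prequotient : SysQFan M (Omega S) where
  D a b := { ρ | IsFaceOf ρ (preCone S P a) ∧ Relation.EqvGen (preStep S P ρ) a b }
  isQF a _ := (isRatCone_preCone a).isQuasiFan (fun _ h => h.1) fun _ h _ hψ =>
    ⟨hψ.trans h.1, h.2.mono fun _ _ h' => ⟨h'.1, hψ.trans h'.2⟩⟩
  symm _ _ := Set.ext fun _ =>
    ⟨fun h => ⟨(isFaceOf_preCone_of_eqvGen h.2).1 h.1, h.2.symm⟩,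
      fun h => ⟨(isFaceOf_preCone_of_eqvGen h.2).1 h.1, h.2.symm⟩⟩
  inter _ _ _ := fun _ h => ⟨h.1.1, h.1.2.trans _ _ _ h.2.2⟩

theorem prequotient_isAffine : (prequotient S P).IsAffine := fun a =>
  ⟨preCone S P a, Set.ext fun _ => ⟨fun h => h.1, fun h => ⟨h, .refl a⟩⟩⟩

variable {S P} in
/-- The class of a face of a chart of the prequotient. -/
def preCls {ρ : Set (NR M)} {a : Omega S} (h : IsFaceOf ρ (preCone S P a)) :
    Omega (prequotient S P) := cls ⟨(ρ, a), h, .refl a⟩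

/-- The projection of `Ω(S)` onto the prequotient. -/
def preProj (a : Omega S) : Omega (prequotient S P) :=
  preCls (IsFaceOf.refl (isRatCone_preCone (P := P) a).isConeSet)

variable {S P}

theorem exists_preCls (t : Omega (prequotient S P)) :
    ∃ (ρ : Set (NR M)) (a : Omega S) (h : IsFaceOf ρ (preCone S P a)), preCls h = t := by
  obtain ⟨⟨⟨ρ, a⟩, h⟩, rfl⟩ := exists_cls t
  exact ⟨ρ, a, h.1, rfl⟩

theorem le_preCls_iff {t : Omega (prequotient S P)} {ρ : Set (NR M)} {a : Omega S}
    {h : IsFaceOf ρ (preCone S P a)} :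
    le _ t (preCls h) ↔ ∃ (φ : Set (NR M)) (hφ : IsFaceOf φ ρ), t = preCls (hφ.trans h) :=
  le_cls_iff.trans ⟨fun ⟨φ, _, h', ht⟩ => ⟨φ, h', ht⟩,
    fun ⟨φ, h', ht⟩ => ⟨φ, ⟨h'.trans h, .refl _⟩, h', ht⟩⟩

theorem preCls_le_preProj {ρ : Set (NR M)} {a : Omega S} (h : IsFaceOf ρ (preCone S P a)) :
    le _ (preCls h) (preProj S P a) := le_preCls_iff.2 ⟨ρ, h, rfl⟩

variable (S P) in
theorem isSysMap_preProj : IsSysMap S (prequotient S P) P (preProj S P) := by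
  refine isSysMap_iff.2 ⟨fun a b h => ?_, fun a x hx => map_mem_relint_preCone hx⟩
  have hface : IsFaceOf (preCone S P a) (preCone S P a) :=
    IsFaceOf.refl (isRatCone_preCone a).isConeSet
  exact ⟨_, _, rfl, rfl, isFaceOf_preCone h, hface, .rel _ _ ⟨h, hface⟩⟩

/-- The element `s` of `Ω(S')` is the image that a factorization through the prequotient has to
assign to the class of the face `ρ` of the chart of `a`. -/
def IsPreImage (F : M →ₗ[ℤ] N') (f : Omega S → Omega S') (ρ : Set (NR M)) (a : Omega S)
    (s : Omega S') : Prop :=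
  le S' s (f a) ∧ ∀ x ∈ coneRelint ρ, LinearMap.baseChange ℝ F x ∈ coneRelint (coneOf s)

theorem IsPreImage.unique {ρ : Set (NR M)} {a : Omega S} (h : IsFaceOf ρ (preCone S P a))
    {s s' : Omega S'} (hs : IsPreImage F f ρ a s) (hs' : IsPreImage F f ρ a s') : s = s' := by
  obtain ⟨x, hx⟩ := ((isRatCone_preCone a).of_isFaceOf h).relint_nonempty
  exact eq_of_coneOf_eq hs.1 hs'.1 (eq_of_mem_relint (isConeSet_coneOf _) (isFaceOf_of_le hs.1)
    (isFaceOf_of_le hs'.1) (hs.2 x hx) (hs'.2 x hx))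

theorem exists_isPreImage (hf : IsSysMap S S' (F.comp P) f) {ρ : Set (NR M)} {a : Omega S}
    (h : IsFaceOf ρ (preCone S P a)) : ∃ s, IsPreImage F f ρ a s := by
  obtain ⟨w, hw⟩ := ((isRatCone_preCone a).of_isFaceOf h).relint_nonempty
  have hmap : ∀ x ∈ ρ, LinearMap.baseChange ℝ F x ∈ coneOf (f a) := fun x hx =>
    map_mem_of_mem_preCone hf (h.2.1 hx)
  have hcone := isConeSet_coneOf (f a)
  have hface := isFaceOf_faceAt hcone (hmap w hw.1)
  obtain ⟨s, hs, hsw⟩ := exists_le_of_isFaceOf hface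
  refine ⟨s, hs, fun x hx => ?_⟩
  rw [hsw]
  refine map_mem_relint hface.1 _ (fun y hy => ⟨hmap y hy, ?_⟩) hw.1
    (mem_relint_faceAt hcone (hmap w hw.1)) hx
  obtain ⟨ε, hε, h'⟩ := hw.2 y hy
  exact ⟨ε, hε, by simpa using hmap _ h'⟩

theorem isPreImage_iff_of_eqvGen (hf : IsSysMap S S' (F.comp P) f) {ρ : Set (NR M)}
    {a b : Omega S} (h : Relation.EqvGen (preStep S P ρ) a b) (s : Omega S') :
    IsPreImage F f ρ a s ↔ IsPreImage F f ρ b s := by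
  induction h with
  | rel a b h =>
    have key : ∀ s, IsPreImage F f ρ a s → IsPreImage F f ρ b s := fun s hs =>
      ⟨le_trans hs.1 (hf.1 a b h.1), hs.2⟩
    refine ⟨key s, fun hs => ?_⟩
    obtain ⟨s', hs'⟩ := exists_isPreImage hf h.2
    rwa [hs.unique (h.2.trans (isFaceOf_preCone h.1)) (key s' hs')]
  | refl => rfl
  | symm _ _ _ ih => exact ih.symm
  | trans _ _ _ _ _ ih ih' => exact ih.trans ih'

/-- A map of systems factoring through `P` on lattices factors uniquely on `Ω` through the
prequotient along `P`. -/
theorem existsUnique_factorization (hf : IsSysMap S S' (F.comp P) f) :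
    ∃! g : Omega (prequotient S P) → Omega S',
      IsSysMap (prequotient S P) S' F g ∧ f = g ∘ preProj S P := by
  have hex : ∀ t : Omega (prequotient S P), ∃ s, ∀ (ρ : Set (NR M)) (a : Omega S)
      (h : IsFaceOf ρ (preCone S P a)), preCls h = t → IsPreImage F f ρ a s := by
    intro t
    obtain ⟨ρ, a, h, rfl⟩ := exists_preCls t
    obtain ⟨s, hs⟩ := exists_isPreImage hf h
    refine ⟨s, fun ρ' a' h' ht => ?_⟩
    obtain ⟨hρ, -, hg⟩ := cls_eq_iff.1 ht
    obtain rfl : ρ' = ρ := hρ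
    exact (isPreImage_iff_of_eqvGen hf hg s).2 hs
  choose g hg using hex
  have hg' : ∀ {ρ : Set (NR M)} {a : Omega S} (h : IsFaceOf ρ (preCone S P a)),
      IsPreImage F f ρ a (g (preCls h)) := fun h => hg _ _ _ h rfl
  refine ⟨g, ⟨isSysMap_iff.2 ⟨fun t t' htt' => ?_, fun t x hx => ?_⟩, funext fun a => ?_⟩, ?_⟩
  · obtain ⟨ρ', a, h', rfl⟩ := exists_preCls t'
    obtain ⟨ρ, hρ, rfl⟩ := le_preCls_iff.1 htt'
    have hs := hg' (hρ.trans h')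
    have hs' := hg' h'
    refine le_of_subset hs.1 hs'.1 ?_
    obtain ⟨w, hw⟩ := ((isRatCone_preCone a).of_isFaceOf (hρ.trans h')).relint_nonempty
    refine (isFaceOf_of_le hs'.1).subset_of_mem_relint (isConeSet_coneOf _)
      (isFaceOf_of_le hs.1).2.1 (hs.2 w hw) ?_
    obtain ⟨w', hw'⟩ := ((isRatCone_preCone a).of_isFaceOf h').relint_nonempty
    obtain ⟨ε, hε, hε'⟩ := hw'.2 w (hρ.2.1 hw.1)
    have hmap : ∀ x ∈ ρ', LinearMap.baseChange ℝ F x ∈ coneOf (f a) := fun x hx =>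
      map_mem_of_mem_preCone hf (h'.2.1 hx)
    have := (isFaceOf_of_le hs'.1).2.2 _ (hmap _ hε') _
      ((isConeSet_coneOf (f a)).2.2 ε hε.le _ (hmap w (hρ.2.1 hw.1)))
      (by simpa using (hs'.2 w' hw').1)
    exact (isConeSet_coneOf _).mem_of_smul_mem hε this.2
  · obtain ⟨ρ, a, h, rfl⟩ := exists_preCls t
    exact (hg' h).2 x hx
  · have hface : IsFaceOf (preCone S P a) (preCone S P a) :=
      IsFaceOf.refl (isRatCone_preCone a).isConeSet
    refine IsPreImage.unique hface ⟨le_refl _, fun x hx => ?_⟩ (hg' hface)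
    obtain ⟨w, hw⟩ := (isRatCone_coneOf a).relint_nonempty
    refine map_mem_relint (isConeSet_coneOf _) _ (fun x hx => map_mem_of_mem_preCone hf hx)
      (map_mem_relint_preCone hw).1 ?_ hx
    simpa [LinearMap.baseChange_comp] using (isSysMap_iff.1 hf).2 a w hw
  · rintro g' ⟨hg₁, rfl⟩
    rw [isSysMap_iff] at hg₁
    funext t
    obtain ⟨ρ, a, h, rfl⟩ := exists_preCls t
    exact IsPreImage.unique h ⟨hg₁.1 _ _ (preCls_le_preProj h), hg₁.2 (preCls h)⟩ (hg' h)

end Prequotient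

end SysQFan

/-- **Existence of prequotients** (Theorem 7.5).  For every affine system of quasi-fans
`S` in a lattice `N` and every primitive sublattice `L` of `N` there exists a prequotient
of `S` by `L`: a map `(P,𝔭)` of systems of quasi-fans from `S` to an affine system of
quasi-fans `S̃` in some lattice `Ñ` with `L ⊆ ker P` such that every map `(F,𝔣)` of
systems of quasi-fans from `S` to an affine system of quasi-fans `S'` with `F|_L = 0`
factors uniquely as `(F,𝔣) = (F̃,𝔣̃) ∘ (P,𝔭)`. -/
theorem prequotient_exists
    {N : Type} [AddCommGroup N] [Module.Free ℤ N] [Module.Finite ℤ N]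
    {I : Type} [Finite I]
    (S : SysQFan N I) (hS : S.IsAffine)
    (L : Submodule ℤ N) (hL : TorsionFreeQuot L) :
    ∃ (M : LatticeData) (J : Type) (_ : Finite J) (T : SysQFan M.carrier J)
      (P : N →ₗ[ℤ] M.carrier) (p : SysQFan.Omega S → SysQFan.Omega T),
      T.IsAffine ∧ SysQFan.IsSysMap S T P p ∧ (∀ x ∈ L, P x = 0) ∧
        ∀ (M' : LatticeData) (J' : Type), Finite J' →
          ∀ (S' : SysQFan M'.carrier J'), S'.IsAffine →
          ∀ (F : N →ₗ[ℤ] M'.carrier) (f : SysQFan.Omega S → SysQFan.Omega S'),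
          SysQFan.IsSysMap S S' F f → (∀ x ∈ L, F x = 0) →
          ∃! Ff : (M.carrier →ₗ[ℤ] M'.carrier) × (SysQFan.Omega T → SysQFan.Omega S'),
            SysQFan.IsSysMap T S' Ff.1 Ff.2 ∧ F = Ff.1.comp P ∧ f = Ff.2 ∘ p := by
  let P : N →+ N ⧸ L := (QuotientAddGroup.mk' L.toAddSubgroup : N →+ N ⧸ L.toAddSubgroup)
  have hP : Function.Surjective P := QuotientAddGroup.mk'_surjective _
  have hPL : ∀ x ∈ L, P x = 0 := fun x hx => (QuotientAddGroup.eq_zero_iff x).2 hx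
  have : Module.Finite ℤ (N ⧸ L) := Module.Finite.of_surjective P.toIntLinearMap hP
  have : Module.IsTorsionFree ℤ (N ⧸ L) := Module.IsTorsionFree.of_smul_eq_zero hL
  let Q : N →ₗ[ℤ] N ⧸ L := P.toIntLinearMap
  refine ⟨⟨N ⧸ L⟩, S.Omega, SysQFan.finite_omega S, S.prequotient Q, Q, S.preProj Q,
    S.prequotient_isAffine Q, S.isSysMap_preProj Q, hPL, ?_⟩
  intro M' J' _ S' _ F f hf hF
  obtain ⟨F', rfl⟩ : ∃ F' : N ⧸ L →ₗ[ℤ] M'.carrier, F = F'.comp Q :=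
    ⟨(QuotientAddGroup.lift L.toAddSubgroup F.toAddMonoidHom hF :
      N ⧸ L →+ M'.carrier).toIntLinearMap, rfl⟩
  obtain ⟨g, hg, huniq⟩ := SysQFan.existsUnique_factorization hf
  refine ⟨(F', g), ⟨hg.1, rfl, hg.2⟩, ?_⟩
  rintro ⟨F₂, g₂⟩ ⟨h₁, h₂, h₃⟩
  obtain rfl : F' = F₂ := LinearMap.ext fun x => by
    obtain ⟨n, rfl⟩ := hP x
    exact LinearMap.congr_fun h₂ n
  rw [huniq g₂ ⟨h₁, h₃⟩]
end

section
/- Let V be a finite-dimensional real vector space, σ a convex polyhedral cone in V, W a linear subspace of V, and P : V → V/W the canonical projection. Then the assignment τ̃ ↦ P⁻¹(τ̃) ∩ σ defines an injective map from the set of faces of the cone P(σ) to the set of faces of σ. -/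
open scoped Pointwise

/-- A convex polyhedral cone in a real vector space: the set of all nonnegative linear
combinations of finitely many vectors. -/
def IsPolyCone {V : Type*} [AddCommGroup V] [Module ℝ V] (σ : Set V) : Prop :=
  ∃ (m : ℕ) (g : Fin m → V),
    σ = { x | ∃ c : Fin m → ℝ, (∀ k, 0 ≤ c k) ∧ x = ∑ k, c k • g k }

/-- The smallest face of the cone `σ` containing the subset `A ⊆ σ`. -/
def minFaceContaining {V : Type*} [AddCommGroup V] [Module ℝ V] (σ A : Set V) : Set V :=
  ⋂₀ { τ | IsFaceOf τ σ ∧ A ⊆ τ }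

theorem IsPolyCone.isConeSet {V : Type*} [AddCommGroup V] [Module ℝ V] {σ : Set V}
    (hσ : IsPolyCone σ) : IsConeSet σ := by
  obtain ⟨m, g, rfl⟩ := hσ
  refine ⟨⟨0, by simp⟩, ?_, ?_⟩
  · rintro _ ⟨a, ha, rfl⟩ _ ⟨b, hb, rfl⟩
    exact ⟨a + b, fun k => add_nonneg (ha k) (hb k), by simp [add_smul, Finset.sum_add_distrib]⟩
  · rintro c hc _ ⟨a, ha, rfl⟩
    exact ⟨c • a, fun k => mul_nonneg hc (ha k), by simp [Finset.smul_sum, mul_smul]⟩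

/-- The preimage in `σ` of a face of the image of a cone `σ` is a face of `σ`. -/
theorem IsFaceOf.preimage_inter {V V' : Type*} [AddCommGroup V] [Module ℝ V] [AddCommGroup V']
    [Module ℝ V'] {σ : Set V} (hσ : IsConeSet σ) (f : V →ₗ[ℝ] V') {τ : Set V'}
    (hτ : IsFaceOf τ (f '' σ)) : IsFaceOf (f ⁻¹' τ ∩ σ) σ := by
  obtain ⟨⟨h0, hadd, hsmul⟩, -, hface⟩ := hτ
  obtain ⟨hσ0, hσadd, hσsmul⟩ := hσ
  refine ⟨⟨⟨by simpa using h0, hσ0⟩, ?_, ?_⟩, Set.inter_subset_right, ?_⟩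
  · rintro x ⟨hx, hxσ⟩ y ⟨hy, hyσ⟩
    exact ⟨by simpa using hadd _ hx _ hy, hσadd x hxσ y hyσ⟩
  · rintro c hc x ⟨hx, hxσ⟩
    exact ⟨by simpa using hsmul c hc _ hx, hσsmul c hc x hxσ⟩
  · rintro x hx y hy ⟨hxy, -⟩
    have h := hface (f x) ⟨x, hx, rfl⟩ (f y) ⟨y, hy, rfl⟩ (by simpa using hxy)
    exact ⟨⟨h.1, hx⟩, ⟨h.2, hy⟩⟩

/-- **Remark 5.2 (i).**  For a convex polyhedral cone `σ` in a finite dimensional real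
vector space `V`, a linear subspace `W ⊆ V` and the projection `P : V → V/W`, the
assignment `τ̃ ↦ P⁻¹(τ̃) ∩ σ` is an injective map from the set of faces of `P(σ)` to the
set of faces of `σ`. -/
theorem face_preimage_injective
    {V : Type*} [AddCommGroup V] [Module ℝ V] [FiniteDimensional ℝ V]
    (σ : Set V) (hσ : IsPolyCone σ) (W : Submodule ℝ V) :
    (∀ τ' : Set (V ⧸ W), IsFaceOf τ' (W.mkQ '' σ) → IsFaceOf (W.mkQ ⁻¹' τ' ∩ σ) σ) ∧
      Set.InjOn (fun τ' : Set (V ⧸ W) => W.mkQ ⁻¹' τ' ∩ σ)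
        { τ' | IsFaceOf τ' (W.mkQ '' σ) } := by
  refine ⟨fun τ' hτ' => hτ'.preimage_inter hσ.isConeSet W.mkQ, ?_⟩
  intro τ₁ h₁ τ₂ h₂ h
  have h' : W.mkQ '' (W.mkQ ⁻¹' τ₁ ∩ σ) = W.mkQ '' (W.mkQ ⁻¹' τ₂ ∩ σ) := congrArg _ h
  rwa [Set.image_preimage_inter, Set.image_preimage_inter, Set.inter_eq_left.2 h₁.2.1,
    Set.inter_eq_left.2 h₂.2.1] at h'
end
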